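/- Suppose the channel N_B is less divergence contracting: for every n ≥ 1 and all states ρ, ρ̂ on (ℂ^{d_A})^{⊗n} such that the support of N_B^{⊗n}(ρ) is contained in the support of N_B^{⊗n}(ρ̂) and the support of N_E^{⊗n}(ρ) is contained in the support of N_E^{⊗n}(ρ̂), one has D(N_B^{⊗n}(ρ)‖N_B^{⊗n}(ρ̂)) ≥ D(N_E^{⊗n}(ρ)‖N_E^{⊗n}(ρ̂)). Then for every n ≥ 1, the maximal coherent information of the n-fold channel satisfies max_{ρ on (ℂ^{d_A})^{⊗n}} I_c^{(n)}(ρ) ≤ n · max_{ρ on ℂ^{d_A}} I_c^{(1)}(ρ); that is, Q^{(1)}(N_B^{⊗n}) ≤ n Q^{(1)}(N_B). -/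

import Mathlib

open Matrix BigOperators
open scoped ComplexOrder

noncomputable section

/-- Matrix logarithm via the spectral decomposition (junk value `0` off Hermitian matrices;
eigenvalue `0` contributes `Real.log 0 = 0`). -/
def matLog {n : Type*} [Fintype n] [DecidableEq n] (ρ : Matrix n n ℂ) : Matrix n n ℂ :=
  if h : ρ.IsHermitian then
    (h.eigenvectorUnitary : Matrix n n ℂ) *
      Matrix.diagonal (fun i => (Real.log (h.eigenvalues i) : ℂ)) *
      (h.eigenvectorUnitary : Matrix n n ℂ)ᴴ
  else 0

/-- Von Neumann entropy `H(ρ) = -Tr[ρ log ρ]`. -/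
def vnEntropy {n : Type*} [Fintype n] [DecidableEq n] (ρ : Matrix n n ℂ) : ℝ :=
  - (ρ * matLog ρ).trace.re

/-- Quantum relative entropy `D(ρ‖σ) = Tr[ρ (log ρ - log σ)]`. -/
def relEntropy {n : Type*} [Fintype n] [DecidableEq n] (ρ σ : Matrix n n ℂ) : ℝ :=
  (ρ * (matLog ρ - matLog σ)).trace.re

/-- A state: positive semidefinite with unit trace. -/
def IsState {n : Type*} [Fintype n] (ρ : Matrix n n ℂ) : Prop :=
  ρ.PosSemidef ∧ ρ.trace = 1

/-- A pure (rank-one) state `|ψ⟩⟨ψ|` for a unit vector `ψ`. -/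
def IsPureState {n : Type*} [Fintype n] (ρ : Matrix n n ℂ) : Prop :=
  ∃ ψ : n → ℂ, (∑ i, Complex.normSq (ψ i)) = 1 ∧ ρ = Matrix.vecMulVec ψ (star ψ)

/-- Support (range) inclusion for matrices. -/
def suppLE {n : Type*} [Fintype n] [DecidableEq n] (ρ σ : Matrix n n ℂ) : Prop :=
  LinearMap.range (Matrix.toLin' ρ) ≤ LinearMap.range (Matrix.toLin' σ)

/-- Partial trace over the second tensor factor. -/
def ptraceSnd {α β : Type*} [Fintype β] (M : Matrix (α × β) (α × β) ℂ) : Matrix α α ℂ :=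
  Matrix.of fun i j => ∑ k, M (i, k) (j, k)

/-- Partial trace over the first tensor factor. -/
def ptraceFst {α β : Type*} [Fintype α] (M : Matrix (α × β) (α × β) ℂ) : Matrix β β ℂ :=
  Matrix.of fun i j => ∑ k, M (k, i) (k, j)

variable {dA dB dE : ℕ}

/-- The channel `N_B(ρ) = Tr_E[U ρ U†]`. -/
def chanB (U : Matrix (Fin dB × Fin dE) (Fin dA) ℂ) (ρ : Matrix (Fin dA) (Fin dA) ℂ) :
    Matrix (Fin dB) (Fin dB) ℂ := ptraceSnd (U * ρ * Uᴴ)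

/-- The complementary channel `N_E(ρ) = Tr_B[U ρ U†]`. -/
def chanE (U : Matrix (Fin dB × Fin dE) (Fin dA) ℂ) (ρ : Matrix (Fin dA) (Fin dA) ℂ) :
    Matrix (Fin dE) (Fin dE) ℂ := ptraceFst (U * ρ * Uᴴ)

/-- Coherent information `I_c(ρ) = H(N_B(ρ)) - H(N_E(ρ))`. -/
def cohInfo (U : Matrix (Fin dB × Fin dE) (Fin dA) ℂ) (ρ : Matrix (Fin dA) (Fin dA) ℂ) : ℝ :=
  vnEntropy (chanB U ρ) - vnEntropy (chanE U ρ)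

/-- Holevo quantity of the ensemble `(p, σ)` with respect to the channel `N`. -/
def holevo {ι inn out : Type*} [Fintype ι] [Fintype out] [DecidableEq out]
    [AddCommMonoid (Matrix inn inn ℂ)]
    (N : Matrix inn inn ℂ → Matrix out out ℂ)
    (p : ι → ℝ) (σ : ι → Matrix inn inn ℂ) : ℝ :=
  vnEntropy (N (∑ u, (p u : ℂ) • σ u)) - ∑ u, p u * vnEntropy (N (σ u))

/-- A finite ensemble: a probability distribution together with states. -/
def IsEnsemble {ι inn : Type*} [Fintype ι] [Fintype inn]
    (p : ι → ℝ) (σ : ι → Matrix inn inn ℂ) : Prop :=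
  (∀ u, 0 ≤ p u) ∧ (∑ u, p u = 1) ∧ (∀ u, IsState (σ u))

/-- `Q^{(1)}`: optimized coherent information. -/
def Q1 (U : Matrix (Fin dB × Fin dE) (Fin dA) ℂ) : ℝ :=
  sSup { r | ∃ ρ, IsState ρ ∧ r = cohInfo U ρ }

/-- `C_p^{(1)}`: optimized difference of Holevo quantities. -/
def Cp1 (U : Matrix (Fin dB × Fin dE) (Fin dA) ℂ) : ℝ :=
  sSup { r | ∃ (m : ℕ) (p : Fin m → ℝ) (σ : Fin m → Matrix (Fin dA) (Fin dA) ℂ),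
    IsEnsemble p σ ∧ r = holevo (chanB U) p σ - holevo (chanE U) p σ }

/-- The `n`-fold tensor power `U^{⊗n}`, as a matrix from `(ℂ^{d_A})^{⊗n}`
to `(ℂ^{d_B})^{⊗n} ⊗ (ℂ^{d_E})^{⊗n}`. -/
def tensorPowIso (U : Matrix (Fin dB × Fin dE) (Fin dA) ℂ) (n : ℕ) :
    Matrix ((Fin n → Fin dB) × (Fin n → Fin dE)) (Fin n → Fin dA) ℂ :=
  Matrix.of fun be a => ∏ i, U (be.1 i, be.2 i) (a i)

/-- The `n`-fold channel `N_B^{⊗n}`. -/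
def chanBn (U : Matrix (Fin dB × Fin dE) (Fin dA) ℂ) (n : ℕ)
    (ρ : Matrix (Fin n → Fin dA) (Fin n → Fin dA) ℂ) :
    Matrix (Fin n → Fin dB) (Fin n → Fin dB) ℂ :=
  ptraceSnd (tensorPowIso U n * ρ * (tensorPowIso U n)ᴴ)

/-- The `n`-fold complementary channel `N_E^{⊗n}`. -/
def chanEn (U : Matrix (Fin dB × Fin dE) (Fin dA) ℂ) (n : ℕ)
    (ρ : Matrix (Fin n → Fin dA) (Fin n → Fin dA) ℂ) :
    Matrix (Fin n → Fin dE) (Fin n → Fin dE) ℂ :=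
  ptraceFst (tensorPowIso U n * ρ * (tensorPowIso U n)ᴴ)

/-- Coherent information of the `n`-fold channel. -/
def cohInfoN (U : Matrix (Fin dB × Fin dE) (Fin dA) ℂ) (n : ℕ)
    (ρ : Matrix (Fin n → Fin dA) (Fin n → Fin dA) ℂ) : ℝ :=
  vnEntropy (chanBn U n ρ) - vnEntropy (chanEn U n ρ)

/-- `Q^{(1)}(N_B^{⊗n})`. -/
def Q1n (U : Matrix (Fin dB × Fin dE) (Fin dA) ℂ) (n : ℕ) : ℝ :=
  sSup { r | ∃ ρ, IsState ρ ∧ r = cohInfoN U n ρ }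

/-- `C_p^{(1)}(N_B^{⊗n})`. -/
def Cp1n (U : Matrix (Fin dB × Fin dE) (Fin dA) ℂ) (n : ℕ) : ℝ :=
  sSup { r | ∃ (m : ℕ) (p : Fin m → ℝ)
    (σ : Fin m → Matrix (Fin n → Fin dA) (Fin n → Fin dA) ℂ),
    IsEnsemble p σ ∧ r = holevo (chanBn U n) p σ - holevo (chanEn U n) p σ }

/-- Quantum capacity `Q(N_B) = sup_{n ≥ 1} Q^{(1)}(N_B^{⊗n}) / n`. -/
def Qcap (U : Matrix (Fin dB × Fin dE) (Fin dA) ℂ) : ℝ :=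
  sSup { r | ∃ n : ℕ, 1 ≤ n ∧ r = Q1n U n / n }

/-- Private capacity `C_p(N_B) = sup_{n ≥ 1} C_p^{(1)}(N_B^{⊗n}) / n`. -/
def Cpcap (U : Matrix (Fin dB × Fin dE) (Fin dA) ℂ) : ℝ :=
  sSup { r | ∃ n : ℕ, 1 ≤ n ∧ r = Cp1n U n / n }

set_option linter.unusedSectionVars false

section helpers

variable {ι α β γ ε : Type*} [Fintype ι] [DecidableEq ι] [Fintype α] [DecidableEq α]
  [Fintype β] [DecidableEq β] [Fintype γ] [DecidableEq γ] [Fintype ε] [DecidableEq ε]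

theorem spec_exists {σ : Matrix α α ℂ} (h : σ.IsHermitian) :
    ∃ (V : Matrix α α ℂ) (d : α → ℝ), Vᴴ * V = 1 ∧ V * Vᴴ = 1 ∧
      σ = V * diagonal (fun i => (d i : ℂ)) * Vᴴ := by
  have w1 : (h.eigenvectorUnitary : Matrix α α ℂ)ᴴ * (h.eigenvectorUnitary : Matrix α α ℂ) = 1 :=
    Unitary.coe_star_mul_self h.eigenvectorUnitary
  have w2 : (h.eigenvectorUnitary : Matrix α α ℂ) * (h.eigenvectorUnitary : Matrix α α ℂ)ᴴ = 1 :=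
    Unitary.coe_mul_star_self h.eigenvectorUnitary
  have w3 : σ = (h.eigenvectorUnitary : Matrix α α ℂ) *
      diagonal (fun i => (h.eigenvalues i : ℂ)) * (h.eigenvectorUnitary : Matrix α α ℂ)ᴴ :=
    h.spectral_theorem
  exact ⟨_, _, w1, w2, w3⟩

theorem isHermitian_of_spec {V : Matrix α α ℂ} {d : α → ℝ} :
    (V * diagonal (fun i => (d i : ℂ)) * Vᴴ).IsHermitian := by
  apply Matrix.isHermitian_mul_mul_conjTranspose
  rw [Matrix.IsHermitian, diagonal_conjTranspose]
  congr 1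
  ext i
  simp

theorem matLog_spec {σ : Matrix α α ℂ} {V : Matrix α α ℂ} {d : α → ℝ}
    (hV : Vᴴ * V = 1) (hV' : V * Vᴴ = 1) (hσ : σ = V * diagonal (fun i => (d i : ℂ)) * Vᴴ) :
    matLog σ = V * diagonal (fun i => (Real.log (d i) : ℂ)) * Vᴴ := by
  have h : σ.IsHermitian := hσ ▸ isHermitian_of_spec
  rw [matLog, dif_pos h]
  set W : Matrix α α ℂ := (h.eigenvectorUnitary).1 with hW
  have w1 : Wᴴ * W = 1 := Unitary.coe_star_mul_self h.eigenvectorUnitary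
  have w2 : W * Wᴴ = 1 := Unitary.coe_mul_star_self h.eigenvectorUnitary
  have hs : σ = W * diagonal (fun i => (h.eigenvalues i : ℂ)) * Wᴴ := h.spectral_theorem
  have h1 : diagonal (fun i => (h.eigenvalues i : ℂ)) * (Wᴴ * V)
      = (Wᴴ * V) * diagonal (fun i => (d i : ℂ)) := by
    calc _ = (Wᴴ * W) * diagonal (fun i => (h.eigenvalues i : ℂ)) * (Wᴴ * V) := by
            rw [w1, one_mul]
      _ = Wᴴ * (W * diagonal (fun i => (h.eigenvalues i : ℂ)) * Wᴴ) * V := by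
            simp only [mul_assoc]
      _ = Wᴴ * (V * diagonal (fun i => (d i : ℂ)) * Vᴴ) * V := by rw [← hs, ← hσ]
      _ = (Wᴴ * V) * diagonal (fun i => (d i : ℂ)) * (Vᴴ * V) := by
            simp only [mul_assoc]
      _ = _ := by rw [hV, mul_one]
  have h2 : diagonal (fun i => (Real.log (h.eigenvalues i) : ℂ)) * (Wᴴ * V)
      = (Wᴴ * V) * diagonal (fun i => (Real.log (d i) : ℂ)) := by
    ext i j
    have := congrFun (congrFun h1 i) j
    rw [diagonal_mul, mul_diagonal] at this ⊢
    by_cases hx : (Wᴴ * V) i j = 0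
    · simp [hx]
    · have e : (h.eigenvalues i : ℂ) = d j := by
        apply mul_right_cancel₀ hx
        rw [this, mul_comm]
      have e' : h.eigenvalues i = d j := by exact_mod_cast e
      rw [e', mul_comm]
  calc _ = W * diagonal (fun i => (Real.log (h.eigenvalues i) : ℂ)) * Wᴴ * (V * Vᴴ) := by
        rw [hV', mul_one]
    _ = W * (diagonal (fun i => (Real.log (h.eigenvalues i) : ℂ)) * (Wᴴ * V)) * Vᴴ := by
        simp only [mul_assoc]
    _ = (W * Wᴴ) * V * diagonal (fun i => (Real.log (d i) : ℂ)) * Vᴴ := by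
        rw [h2]; simp only [mul_assoc]
    _ = _ := by rw [w2, one_mul]

/-- tensor product of a family of matrices -/
def tens (M : ι → Matrix α β ℂ) : Matrix (ι → α) (ι → β) ℂ :=
  Matrix.of fun x y => ∏ i, M i (x i) (y i)

theorem tens_mul (M : ι → Matrix α β ℂ) (N : ι → Matrix β γ ℂ) :
    tens M * tens N = tens (fun i => M i * N i) := by
  ext x y
  simp only [tens, mul_apply, of_apply]
  rw [Finset.prod_univ_sum, Fintype.piFinset_univ]
  simp only [Finset.prod_mul_distrib]

theorem tens_conjTranspose (M : ι → Matrix α β ℂ) :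
    (tens M)ᴴ = tens (fun i => (M i)ᴴ) := by
  ext x y
  simp [tens, conjTranspose_apply]

theorem tens_diagonal (d : ι → α → ℂ) :
    tens (fun i => diagonal (d i)) = diagonal (fun x : ι → α => ∏ i, d i (x i)) := by
  ext x y
  simp only [tens, of_apply]
  by_cases h : x = y
  · subst h; simp
  · rw [diagonal_apply_ne _ h]
    obtain ⟨i, hi⟩ := Function.ne_iff.mp h
    exact Finset.prod_eq_zero (Finset.mem_univ i) (diagonal_apply_ne _ hi)

theorem tens_one : tens (fun _ : ι => (1 : Matrix α α ℂ)) = 1 := by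
  simp only [← diagonal_one]
  rw [tens_diagonal]
  simp

theorem tens_posSemidef {M : ι → Matrix α α ℂ} (h : ∀ i, (M i).PosSemidef) :
    (tens M).PosSemidef := by
  have : ∀ i, ∃ B : Matrix α α ℂ, M i = Bᴴ * B := fun i => by
    obtain ⟨V, d, hV, hV', hs⟩ := spec_exists (h i).isHermitian
    have hd : ∀ j, 0 ≤ d j := by
      intro j
      have h1 := (h i).conjTranspose_mul_mul_same V
      have h2 : Vᴴ * M i * V = diagonal (fun i => (d i : ℂ)) := by
        rw [hs]
        calc _ = (Vᴴ * V) * diagonal (fun i => (d i : ℂ)) * (Vᴴ * V) := by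
              simp only [mul_assoc]
          _ = _ := by rw [hV, one_mul, mul_one]
      rw [h2, posSemidef_diagonal_iff] at h1
      exact_mod_cast h1 j
    refine ⟨diagonal (fun i => (Real.sqrt (d i) : ℂ)) * Vᴴ, ?_⟩
    rw [conjTranspose_mul, conjTranspose_conjTranspose, diagonal_conjTranspose, hs]
    have : diagonal (fun i => (d i : ℂ)) = diagonal (star fun i => (Real.sqrt (d i) : ℂ)) *
        diagonal (fun i => (Real.sqrt (d i) : ℂ)) := by
      rw [diagonal_mul_diagonal]
      congr 1
      ext j
      simp only [Pi.star_apply, RCLike.star_def, Complex.conj_ofReal]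
      rw [← Complex.ofReal_mul, Real.mul_self_sqrt (hd j)]
    rw [this]
    simp only [mul_assoc]
  choose B hB using this
  have e : tens M = (tens B)ᴴ * tens B := by
    rw [tens_conjTranspose, tens_mul]
    congr 1
    ext1 i
    exact hB i
  rw [e]
  exact posSemidef_conjTranspose_mul_self _

theorem trace_mul_nonneg' {ρ : Matrix α α ℂ} (hρ : ρ.PosSemidef) (B : Matrix β α ℂ) :
    0 ≤ (ρ * (Bᴴ * B)).trace := by
  rw [← Matrix.mul_assoc, Matrix.trace_mul_comm, ← Matrix.mul_assoc]
  exact (hρ.mul_mul_conjTranspose_same B).trace_nonneg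

/-- operator acting on the `i`th factor -/
def lft (i : ι) (X : Matrix α α ℂ) : Matrix (ι → α) (ι → α) ℂ :=
  tens (Function.update (fun _ => 1) i X)

theorem lft_apply (i : ι) (X : Matrix α α ℂ) (x y : ι → α) :
    lft i X x y = X (x i) (y i) *
      ∏ j ∈ Finset.univ.erase i, (1 : Matrix α α ℂ) (x j) (y j) := by
  simp only [lft, tens, of_apply]
  rw [← Finset.mul_prod_erase _ _ (Finset.mem_univ i)]
  rw [Function.update_self]
  congr 1
  refine Finset.prod_congr rfl fun j hj => ?_
  rw [Function.update_of_ne (Finset.ne_of_mem_erase hj)]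

theorem tens_lft_tens (i : ι) (X : Matrix α α ℂ) (V : ι → Matrix β α ℂ) (W : ι → Matrix α β ℂ)
    (h : ∀ j, V j * W j = 1) :
    tens V * lft i X * tens W = lft i (V i * X * W i) := by
  rw [lft, lft, tens_mul, tens_mul]
  congr 1
  ext1 j
  by_cases hj : j = i
  · subst hj; simp
  · simp [Function.update_of_ne hj, h]

theorem lft_diagonal (i : ι) (f : α → ℂ) :
    lft i (diagonal f) = diagonal (fun x : ι → α => f (x i)) := by
  have : (Function.update (fun _ => 1) i (diagonal f) : ι → Matrix α α ℂ)
      = fun j => diagonal ((Function.update (fun _ => 1) i f : ι → α → ℂ) j) := by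
    ext1 j
    by_cases hj : j = i
    · subst hj; simp
    · simp only [Function.update_of_ne hj]; exact diagonal_one.symm
  rw [lft, this, tens_diagonal]
  congr 1
  ext x
  rw [Finset.prod_eq_single i]
  · simp
  · intro j _ hj; simp [Function.update_of_ne hj]
  · simp

theorem lft_one (i : ι) : lft i (1 : Matrix α α ℂ) = 1 := by
  rw [← diagonal_one, lft_diagonal]; simp

/-- marginal on the `i`th factor -/
def marg (i : ι) (ρ : Matrix (ι → α) (ι → α) ℂ) : Matrix α α ℂ :=
  Matrix.of fun x y => (ρ * lft i (Matrix.single y x 1)).trace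

theorem trace_marg_mul (i : ι) (ρ : Matrix (ι → α) (ι → α) ℂ) (X : Matrix α α ℂ) :
    (marg i ρ * X).trace = (ρ * lft i X).trace := by
  have hX : lft i X = ∑ x, ∑ y, X y x • lft (ι := ι) i (Matrix.single y x (1:ℂ)) := by
    ext a b
    simp only [Matrix.sum_apply, Matrix.smul_apply, lft_apply, smul_eq_mul]
    simp only [← mul_assoc, ← Finset.sum_mul]
    congr 1
    simp [Matrix.single_apply, ite_and]
  rw [hX]
  simp only [Finset.mul_sum, trace_sum, Matrix.mul_smul, trace_smul, smul_eq_mul]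
  simp only [Matrix.trace, diag_apply, mul_apply (M := marg i ρ)]
  refine Finset.sum_congr rfl fun x _ => Finset.sum_congr rfl fun y _ => ?_
  rw [mul_comm]; rfl

theorem marg_state (i : ι) {ρ : Matrix (ι → α) (ι → α) ℂ} (h : IsState ρ) :
    IsState (marg i ρ) := by
  have hq : ∀ x : α → ℂ, 0 ≤ star x ⬝ᵥ (marg i ρ *ᵥ x) := by
    intro x
    have e : star x ⬝ᵥ (marg i ρ *ᵥ x) = (marg i ρ * vecMulVec x (star x)).trace := by
      rw [Matrix.mul_vecMulVec, Matrix.trace_vecMulVec, dotProduct_comm]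
    rw [e, trace_marg_mul]
    have hp : (lft i (vecMulVec x (star x)) : Matrix (ι → α) (ι → α) ℂ).PosSemidef := by
      apply tens_posSemidef
      intro j
      by_cases hj : j = i
      · subst hj; simpa using posSemidef_vecMulVec_self_star x
      · simpa [Function.update_of_ne hj] using PosSemidef.one
    obtain ⟨B, hB⟩ : ∃ B : Matrix (ι → α) (ι → α) ℂ, lft i (vecMulVec x (star x)) = Bᴴ * B := by
      open scoped MatrixOrder in
      exact CStarAlgebra.nonneg_iff_eq_star_mul_self.mp hp.nonneg
    rw [hB]
    exact trace_mul_nonneg' h.1 B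
  refine ⟨?_, ?_⟩
  · rw [posSemidef_iff_dotProduct_mulVec]
    refine ⟨?_, hq⟩
    refine IsHermitian.ext fun x y => ?_
    simp only [marg, of_apply]
    rw [← trace_conjTranspose, conjTranspose_mul, h.1.isHermitian.eq, Matrix.trace_mul_comm,
      lft, lft, tens_conjTranspose]
    congr 3
    ext1 j
    by_cases hj : j = i
    · subst hj; simp
    · simp [Function.update_of_ne hj]
  · have := trace_marg_mul i ρ 1
    rwa [lft_one, mul_one, mul_one, h.2] at this

theorem posSemidef_col_zero {M : Matrix α α ℂ} (h : M.PosSemidef) {b : α} (hb : M b b = 0)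
    (c : α) : M b c = 0 := by
  have h1 : M *ᵥ Pi.single b 1 = 0 := by
    rw [← h.dotProduct_mulVec_zero_iff]
    simp [hb]
  have h2 : M c b = 0 := by simpa using congrFun h1 c
  rw [← h.isHermitian.apply, h2, star_zero]

theorem core {ω : Matrix (ι → α) (ι → α) ℂ} (hω : IsState ω) :
    suppLE ω (tens fun i => marg i ω) ∧
    (ω * matLog (tens fun i => marg i ω)).trace =
      ∑ i, (marg i ω * matLog (marg i ω)).trace := by
  choose V d hV hV' hs using fun i => spec_exists (marg_state i hω).1.isHermitian
  set VV := tens V with hVV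
  have hA : VVᴴ * VV = 1 := by
    rw [hVV, tens_conjTranspose, tens_mul]
    simp only [hV, tens_one]
  have hA' : VV * VVᴴ = 1 := by
    rw [hVV, tens_conjTranspose, tens_mul]
    simp only [hV', tens_one]
  have hT : (tens fun i => marg i ω) =
      VV * diagonal (fun x : ι → α => ((∏ i, d i (x i) : ℝ) : ℂ)) * VVᴴ := by
    have : (fun x : ι → α => ((∏ i, d i (x i) : ℝ) : ℂ)) = fun x => ∏ i, (d i (x i) : ℂ) := by
      ext x; push_cast; rfl
    rw [this, ← tens_diagonal (fun i x => (d i x : ℂ)), hVV, tens_conjTranspose, tens_mul,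
      tens_mul]
    congr 1
    ext1 i
    exact hs i
  set ω' := VVᴴ * ω * VV with hω'
  have hpsd : ω'.PosSemidef := hω.1.conjTranspose_mul_mul_same VV
  have hback : ω = VV * ω' * VVᴴ := by
    calc ω = (VV * VVᴴ) * ω * (VV * VVᴴ) := by rw [hA', one_mul, mul_one]
      _ = _ := by rw [hω']; simp only [mul_assoc]
  have key : ∀ i (f : α → ℂ), ∑ b, ω' b b * f (b i) = ∑ x, (d i x : ℂ) * f x := by
    intro i f
    have h1 : ∑ b, ω' b b * f (b i) = (ω' * lft i (diagonal f)).trace := by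
      rw [lft_diagonal]
      simp [Matrix.trace]
    have h2 : (ω' * lft i (diagonal f)).trace = (ω * (VV * lft i (diagonal f) * VVᴴ)).trace := by
      rw [hω', mul_assoc, mul_assoc, Matrix.trace_mul_comm]
      simp only [mul_assoc]
    rw [h1, h2, hVV, tens_conjTranspose, tens_lft_tens _ _ _ _ hV', ← trace_marg_mul]
    have h3 : marg i ω * (V i * diagonal f * (V i)ᴴ) =
        V i * (diagonal (fun x => (d i x : ℂ)) * diagonal f) * (V i)ᴴ := by
      conv_lhs => rw [hs i]
      calc _ = V i * diagonal (fun x => (d i x : ℂ)) * ((V i)ᴴ * V i) * diagonal f * (V i)ᴴ := by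
            simp only [mul_assoc]
        _ = _ := by rw [hV, mul_one]; simp only [mul_assoc]
    rw [h3, Matrix.trace_mul_comm, ← mul_assoc, hV, one_mul, diagonal_mul_diagonal,
      trace_diagonal]
  have hz : ∀ b i, d i (b i) = 0 → ω' b b = 0 := by
    intro b i h0
    have h1 := key i (Pi.single (b i) 1)
    have h2 : ∑ x, (d i x : ℂ) * (Pi.single (b i) (1:ℂ) : α → ℂ) x = 0 := by
      simp [Pi.single_apply, h0]
    rw [h2, Finset.sum_eq_zero_iff_of_nonneg] at h1
    · simpa using h1 b (Finset.mem_univ _)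
    · intro c _
      refine mul_nonneg hpsd.diag_nonneg ?_
      by_cases hc : c i = b i
      · simp [hc]
      · simp [Pi.single_apply, hc]
  constructor
  · have e : ω = (tens fun i => marg i ω) *
        (VV * diagonal (fun x : ι → α => ((∏ i, d i (x i) : ℝ) : ℂ)⁻¹) * ω' * VVᴴ) := by
      have e1 : diagonal (fun x : ι → α => ((∏ i, d i (x i) : ℝ) : ℂ)) *
          (diagonal (fun x : ι → α => ((∏ i, d i (x i) : ℝ) : ℂ)⁻¹) * ω') = ω' := by
        ext b c
        rw [diagonal_mul, diagonal_mul]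
        by_cases h0 : ∏ i, d i (b i) = 0
        · obtain ⟨i, _, hi⟩ := Finset.prod_eq_zero_iff.mp h0
          rw [posSemidef_col_zero hpsd (hz b i hi)]; simp
        · rw [mul_inv_cancel_left₀]
          exact_mod_cast h0
      rw [hT]
      calc ω = VV * (diagonal (fun x : ι → α => ((∏ i, d i (x i) : ℝ) : ℂ)) *
          (diagonal (fun x : ι → α => ((∏ i, d i (x i) : ℝ) : ℂ)⁻¹) * ω')) * VVᴴ := by
            rw [e1]; exact hback
        _ = VV * diagonal (fun x : ι → α => ((∏ i, d i (x i) : ℝ) : ℂ)) * (VVᴴ * VV) *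
          diagonal (fun x : ι → α => ((∏ i, d i (x i) : ℝ) : ℂ)⁻¹) * ω' * VVᴴ := by
            rw [hA, mul_one]; simp only [mul_assoc]
        _ = _ := by simp only [mul_assoc]
    unfold suppLE
    rintro _ ⟨v, rfl⟩
    refine ⟨(VV * diagonal (fun x : ι → α => ((∏ i, d i (x i) : ℝ) : ℂ)⁻¹) * ω' * VVᴴ) *ᵥ v, ?_⟩
    rw [toLin'_apply, toLin'_apply, mulVec_mulVec, ← e]
  · rw [matLog_spec hA hA' hT]
    have h1 : (ω * (VV * diagonal (fun x : ι → α => (Real.log (∏ i, d i (x i)) : ℂ)) * VVᴴ)).trace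
        = ∑ b, ω' b b * (Real.log (∏ i, d i (b i)) : ℂ) := by
      rw [← mul_assoc, Matrix.trace_mul_comm, ← mul_assoc, ← mul_assoc]
      simp [Matrix.trace, ← hω']
    rw [h1]
    have h2 : ∀ b, ω' b b * (Real.log (∏ i, d i (b i)) : ℂ) =
        ∑ i, ω' b b * (Real.log (d i (b i)) : ℂ) := by
      intro b
      by_cases h0 : ω' b b = 0
      · simp [h0]
      · rw [Real.log_prod]
        · push_cast; rw [Finset.mul_sum]
        · exact fun i _ hi => h0 (hz b i hi)
    simp only [h2]
    rw [Finset.sum_comm]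
    refine Finset.sum_congr rfl fun i _ => ?_
    rw [key i (fun x => (Real.log (d i x) : ℂ)), matLog_spec (hV i) (hV' i) (hs i)]
    conv_rhs => rw [hs i]
    have h3 : (V i * diagonal (fun x => (d i x : ℂ)) * (V i)ᴴ) *
        (V i * diagonal (fun x => (Real.log (d i x) : ℂ)) * (V i)ᴴ) =
        V i * (diagonal (fun x => (d i x : ℂ)) * diagonal (fun x => (Real.log (d i x) : ℂ)))
          * (V i)ᴴ := by
      calc _ = V i * diagonal (fun x => (d i x : ℂ)) * ((V i)ᴴ * V i) *
            diagonal (fun x => (Real.log (d i x) : ℂ)) * (V i)ᴴ := by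
            simp only [mul_assoc]
        _ = _ := by rw [hV, mul_one]; simp only [mul_assoc]
    rw [h3, Matrix.trace_mul_comm, ← mul_assoc, hV, one_mul, diagonal_mul_diagonal,
      trace_diagonal]

theorem relEntropy_core {ω : Matrix (ι → α) (ι → α) ℂ} (hω : IsState ω) :
    relEntropy ω (tens fun i => marg i ω) = (∑ i, vnEntropy (marg i ω)) - vnEntropy ω := by
  simp only [relEntropy, vnEntropy, mul_sub, trace_sub, Complex.sub_re, (core hω).2,
    Complex.re_sum, Finset.sum_neg_distrib]
  ring

theorem entropy_bounds {ω : Matrix α α ℂ} (hω : IsState ω) :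
    0 ≤ vnEntropy ω ∧ vnEntropy ω ≤ Fintype.card α := by
  obtain ⟨V, d, hV, hV', hs⟩ := spec_exists hω.1.isHermitian
  have hd : ∀ j, 0 ≤ d j := by
    intro j
    have h1 := hω.1.conjTranspose_mul_mul_same V
    have h2 : Vᴴ * ω * V = diagonal (fun i => (d i : ℂ)) := by
      rw [hs]
      calc _ = (Vᴴ * V) * diagonal (fun i => (d i : ℂ)) * (Vᴴ * V) := by
            simp only [mul_assoc]
        _ = _ := by rw [hV, one_mul, mul_one]
    rw [h2, posSemidef_diagonal_iff] at h1
    exact_mod_cast h1 j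
  have hsum : ∑ j, d j = 1 := by
    have := hω.2
    rw [hs, Matrix.trace_mul_comm, ← mul_assoc, hV, one_mul, trace_diagonal] at this
    exact_mod_cast this
  have hle : ∀ j, d j ≤ 1 := fun j => by
    rw [← hsum]; exact Finset.single_le_sum (fun i _ => hd i) (Finset.mem_univ j)
  have hH : vnEntropy ω = ∑ j, Real.negMulLog (d j) := by
    rw [vnEntropy, matLog_spec hV hV' hs]
    have h3 : ω * (V * diagonal (fun x => (Real.log (d x) : ℂ)) * Vᴴ) =
        V * (diagonal (fun x => (d x : ℂ)) * diagonal (fun x => (Real.log (d x) : ℂ))) * Vᴴ := by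
      conv_lhs => rw [hs]
      calc _ = V * diagonal (fun x => (d x : ℂ)) * (Vᴴ * V) *
            diagonal (fun x => (Real.log (d x) : ℂ)) * Vᴴ := by
            simp only [mul_assoc]
        _ = _ := by rw [hV, mul_one]; simp only [mul_assoc]
    rw [h3, Matrix.trace_mul_comm, ← mul_assoc, hV, one_mul, diagonal_mul_diagonal,
      trace_diagonal, Complex.re_sum, ← Finset.sum_neg_distrib]
    refine Finset.sum_congr rfl fun j _ => ?_
    rw [← Complex.ofReal_mul, Complex.ofReal_re, Real.negMulLog]
    ring
  rw [hH]
  constructor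
  · exact Finset.sum_nonneg fun j _ => Real.negMulLog_nonneg (hd j) (hle j)
  · have : ∑ j, Real.negMulLog (d j) ≤ ∑ _j : α, (1:ℝ) := by
      refine Finset.sum_le_sum fun j _ => ?_
      rcases (hd j).eq_or_lt with h0 | h0
      · rw [← h0]; simp
      · have h1 := Real.one_sub_inv_le_log_of_pos h0
        have h2 := mul_le_mul_of_nonneg_left h1 (hd j)
        rw [mul_sub, mul_inv_cancel₀ h0.ne'] at h2
        rw [Real.negMulLog]
        linarith
    simpa using this

theorem ptraceSnd_state {W : Matrix (β × ε) α ℂ} (hW : Wᴴ * W = 1) {ρ : Matrix α α ℂ}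
    (h : IsState ρ) : IsState (ptraceSnd (W * ρ * Wᴴ)) := by
  constructor
  · have e : ptraceSnd (W * ρ * Wᴴ) =
        ∑ k, (W * ρ * Wᴴ).submatrix (fun i => (i, k)) (fun i => (i, k)) := by
      ext i j
      simp [ptraceSnd, Matrix.sum_apply]
    rw [e]
    exact posSemidef_sum _ fun k _ => (h.1.mul_mul_conjTranspose_same W).submatrix _
  · have e : (ptraceSnd (W * ρ * Wᴴ)).trace = (W * ρ * Wᴴ).trace := by
      simp only [Matrix.trace, ptraceSnd, diag_apply, of_apply, Fintype.sum_prod_type]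
    rw [e, Matrix.trace_mul_comm, ← Matrix.mul_assoc, hW, Matrix.one_mul, h.2]

theorem trace_ptraceSnd_mul (M : Matrix (β × ε) (β × ε) ℂ) (X : Matrix β β ℂ) :
    (ptraceSnd M * X).trace = (M * kroneckerMap (· * ·) X (1 : Matrix ε ε ℂ)).trace := by
  simp only [Matrix.trace, diag_apply, mul_apply, ptraceSnd, of_apply, Fintype.sum_prod_type,
    kroneckerMap_apply, one_apply, mul_ite, mul_one, mul_zero, Finset.sum_ite_eq',
    Finset.mem_univ, if_true, Finset.sum_mul]
  refine Finset.sum_congr rfl fun x _ => ?_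
  rw [Finset.sum_comm]

end helpers

section chan

variable {dA dB dE : ℕ}

theorem tpi_eq (U : Matrix (Fin dB × Fin dE) (Fin dA) ℂ) (n : ℕ) :
    tensorPowIso U n = (tens fun _ : Fin n => U).submatrix
      (Equiv.arrowProdEquivProdArrow (Fin n) (fun _ => Fin dB) (fun _ => Fin dE)).symm
      (Equiv.refl _) := by
  ext x y
  rfl

theorem tpi_iso (U : Matrix (Fin dB × Fin dE) (Fin dA) ℂ) (hU : Uᴴ * U = 1) (n : ℕ) :
    (tensorPowIso U n)ᴴ * tensorPowIso U n = 1 := by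
  rw [tpi_eq, conjTranspose_submatrix, submatrix_mul_equiv, tens_conjTranspose, tens_mul]
  simp only [hU, tens_one]
  simp

theorem chanBn_tens (U : Matrix (Fin dB × Fin dE) (Fin dA) ℂ) (n : ℕ)
    (ρ : Fin n → Matrix (Fin dA) (Fin dA) ℂ) :
    chanBn U n (tens ρ) = tens (fun i => chanB U (ρ i)) := by
  have e : tens ρ = (tens ρ).submatrix (Equiv.refl _) (Equiv.refl _) := rfl
  rw [chanBn, tpi_eq, e, conjTranspose_submatrix, submatrix_mul_equiv, submatrix_mul_equiv,
    tens_conjTranspose, tens_mul, tens_mul]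
  ext x y
  simp only [ptraceSnd, tens, chanB, of_apply, submatrix_apply]
  rw [Finset.prod_univ_sum, Fintype.piFinset_univ]
  rfl

theorem marg_chanBn (U : Matrix (Fin dB × Fin dE) (Fin dA) ℂ) (hU : Uᴴ * U = 1) (n : ℕ)
    (ρ : Matrix (Fin n → Fin dA) (Fin n → Fin dA) ℂ) (i : Fin n) :
    marg i (chanBn U n ρ) = chanB U (marg i ρ) := by
  rw [Matrix.ext_iff_trace_mul_right]
  intro X
  rw [trace_marg_mul, chanBn, chanB, trace_ptraceSnd_mul, trace_ptraceSnd_mul]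
  have h1 : ∀ {a b : Type} [Fintype a] [Fintype b] (W : Matrix a b ℂ) (r : Matrix b b ℂ)
      (K : Matrix a a ℂ), (W * r * Wᴴ * K).trace = (r * (Wᴴ * K * W)).trace := by
    intro a b _ _ W r K
    rw [Matrix.mul_assoc, Matrix.mul_assoc, Matrix.trace_mul_comm, Matrix.mul_assoc]
  rw [h1, h1, trace_marg_mul]
  congr 2
  have h2 : kroneckerMap (· * ·) (lft i X) (1 : Matrix (Fin n → Fin dE) (Fin n → Fin dE) ℂ) =
      (lft i (kroneckerMap (· * ·) X (1 : Matrix (Fin dE) (Fin dE) ℂ))).submatrix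
      (Equiv.arrowProdEquivProdArrow (Fin n) (fun _ => Fin dB) (fun _ => Fin dE)).symm
      (Equiv.arrowProdEquivProdArrow (Fin n) (fun _ => Fin dB) (fun _ => Fin dE)).symm := by
    ext ⟨x, x'⟩ ⟨y, y'⟩
    rw [← tens_one]
    simp only [kroneckerMap_apply, lft, tens, of_apply, submatrix_apply]
    rw [← Finset.prod_mul_distrib]
    refine Finset.prod_congr rfl fun j _ => ?_
    by_cases hj : j = i
    · subst hj; simp
    · simp only [Function.update_of_ne hj]
      simp [one_apply, Prod.ext_iff, ite_and, Equiv.arrowProdEquivProdArrow]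
      split_ifs <;> rfl
  rw [h2, tpi_eq, conjTranspose_submatrix, submatrix_mul_equiv, submatrix_mul_equiv,
    tens_conjTranspose, tens_lft_tens _ _ _ _ (fun _ => hU)]
  rfl

theorem chanB_main (U : Matrix (Fin dB × Fin dE) (Fin dA) ℂ) (hU : Uᴴ * U = 1) (n : ℕ)
    {ρ : Matrix (Fin n → Fin dA) (Fin n → Fin dA) ℂ} (h : IsState ρ) :
    suppLE (chanBn U n ρ) (chanBn U n (tens fun i => marg i ρ)) ∧
    relEntropy (chanBn U n ρ) (chanBn U n (tens fun i => marg i ρ)) =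
      (∑ i, vnEntropy (chanB U (marg i ρ))) - vnEntropy (chanBn U n ρ) := by
  have hs : IsState (chanBn U n ρ) := ptraceSnd_state (tpi_iso U hU n) h
  rw [chanBn_tens]
  simp only [← marg_chanBn U hU]
  exact ⟨(core hs).1, relEntropy_core hs⟩

theorem swap_iso (U : Matrix (Fin dB × Fin dE) (Fin dA) ℂ) (hU : Uᴴ * U = 1) :
    (U.submatrix (Equiv.prodComm (Fin dE) (Fin dB)) id)ᴴ *
      (U.submatrix (Equiv.prodComm (Fin dE) (Fin dB)) id) = 1 := by
  rw [conjTranspose_submatrix, submatrix_mul_equiv, hU]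
  simp

theorem chanE_swap (U : Matrix (Fin dB × Fin dE) (Fin dA) ℂ) :
    chanE U = chanB (U.submatrix (Equiv.prodComm (Fin dE) (Fin dB)) id) := by
  ext ρ x y
  rfl

theorem chanEn_swap (U : Matrix (Fin dB × Fin dE) (Fin dA) ℂ) (n : ℕ) :
    chanEn U n = chanBn (U.submatrix (Equiv.prodComm (Fin dE) (Fin dB)) id) n := by
  ext ρ x y
  rfl

theorem tens_state {n : ℕ} {ρ : Fin n → Matrix (Fin dA) (Fin dA) ℂ} (h : ∀ i, IsState (ρ i)) :
    IsState (tens ρ) := by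
  refine ⟨tens_posSemidef fun i => (h i).1, ?_⟩
  have : (tens ρ).trace = ∏ i, (ρ i).trace := by
    simp only [Matrix.trace, diag_apply]
    rw [Finset.prod_univ_sum, Fintype.piFinset_univ]
    rfl
  rw [this]
  simp [(h _).2]

end chan

/-- If the channel is less divergence contracting (at every `n ≥ 1`),
then the maximal coherent information is additive from above:
`Q^{(1)}(N_B^{⊗n}) ≤ n · Q^{(1)}(N_B)` for every `n ≥ 1`. -/
theorem less_divergence_contracting_implies_subadditive_Q1
    {dA dB dE : ℕ} (hdA : 1 ≤ dA) (hdB : 1 ≤ dB) (hdE : 1 ≤ dE)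
    (U : Matrix (Fin dB × Fin dE) (Fin dA) ℂ) (hU : Uᴴ * U = 1)
    (hldc : ∀ n : ℕ, 1 ≤ n →
      ∀ ρ ρhat : Matrix (Fin n → Fin dA) (Fin n → Fin dA) ℂ,
      IsState ρ → IsState ρhat →
      suppLE (chanBn U n ρ) (chanBn U n ρhat) →
      suppLE (chanEn U n ρ) (chanEn U n ρhat) →
      relEntropy (chanEn U n ρ) (chanEn U n ρhat)
        ≤ relEntropy (chanBn U n ρ) (chanBn U n ρhat)) :
    ∀ n : ℕ, 1 ≤ n → Q1n U n ≤ n * Q1 U := by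
  intro n hn
  have hbdd : BddAbove { r | ∃ ρ, IsState ρ ∧ r = cohInfo U ρ } := by
    refine ⟨dB, ?_⟩
    rintro _ ⟨ρ, hρ, rfl⟩
    have h1 := (entropy_bounds (ptraceSnd_state hU hρ)).2
    have h2 : 0 ≤ vnEntropy (chanE U ρ) := by
      rw [chanE_swap]
      exact (entropy_bounds (ptraceSnd_state (swap_iso U hU) hρ)).1
    rw [Fintype.card_fin] at h1
    rw [cohInfo, chanB]
    linarith
  apply csSup_le
  · let a : Fin n → Fin dA := fun _ => ⟨0, hdA⟩
    refine ⟨_, vecMulVec (Pi.single a 1) (star (Pi.single a 1)),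
      ⟨posSemidef_vecMulVec_self_star _, ?_⟩, rfl⟩
    rw [Matrix.trace_vecMulVec]
    simp
  · rintro _ ⟨ρ, hρ, rfl⟩
    have hB := chanB_main U hU n hρ
    have hE := chanB_main _ (swap_iso U hU) n hρ
    rw [← chanEn_swap, ← chanE_swap] at hE
    have h := hldc n hn ρ _ hρ (tens_state fun i => marg_state i hρ) hB.1 hE.1
    rw [hB.2, hE.2] at h
    have hsum : ∑ i, cohInfo U (marg i ρ) ≤ ∑ _i : Fin n, Q1 U :=
      Finset.sum_le_sum fun i _ => le_csSup hbdd ⟨_, marg_state i hρ, rfl⟩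
    simp only [cohInfo, Finset.sum_sub_distrib, Finset.sum_const, Finset.card_univ,
      Fintype.card_fin, nsmul_eq_mul] at hsum
    rw [cohInfoN]
    linarith

end
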